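/- Let G be a connected undirected graph with n ≥ 2 vertices and let L be its (unit-weight) Laplacian matrix. Then for every x ∈ ℝⁿ with x ⊥ 𝟙 (i.e., Σ_i x_i = 0), one has n^{-2} · ‖x‖_∞ ≤ ‖x‖_L, where ‖x‖_L = √(xᵀLx). -/

import Mathlib

open Matrix

/-- Signed edge–vertex incidence matrix of an oriented graph whose `e`-th edge
goes from `(ends e).1` to `(ends e).2`. -/
noncomputable def incB {n m : ℕ} (ends : Fin m → Fin n × Fin n) :
    Matrix (Fin m) (Fin n) ℝ :=
  fun e v =>
    (if v = (ends e).1 then (1 : ℝ) else 0) - (if v = (ends e).2 then (1 : ℝ) else 0)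

/-- `P` is the Moore–Penrose pseudoinverse of `A` (real matrices): the four
Penrose conditions. -/
def IsMoorePenrose {k : ℕ} (A P : Matrix (Fin k) (Fin k) ℝ) : Prop :=
  A * P * A = A ∧ P * A * P = P ∧ (A * P)ᵀ = A * P ∧ (P * A)ᵀ = P * A

/-- The undirected simple graph underlying the oriented edge list `ends`. -/
def graphOf {n m : ℕ} (ends : Fin m → Fin n × Fin n) : SimpleGraph (Fin n) :=
  SimpleGraph.fromRel fun u v => ∃ e, ends e = (u, v)

theorem lap_quad {n m : ℕ} (ends : Fin m → Fin n × Fin n) (x : Fin n → ℝ) :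
    x ⬝ᵥ ((incB ends)ᵀ * incB ends).mulVec x
      = ∑ e, (x (ends e).1 - x (ends e).2) ^ 2 := by
  have h : ∀ e, (incB ends).mulVec x e = x (ends e).1 - x (ends e).2 := by
    intro e
    simp [incB, Matrix.mulVec, dotProduct, sub_mul, Finset.sum_sub_distrib]
  rw [← Matrix.mulVec_mulVec, Matrix.dotProduct_mulVec, Matrix.vecMul_transpose]
  simp [dotProduct, h, sq]

theorem walk_bound {n : ℕ} (G : SimpleGraph (Fin n)) (x : Fin n → ℝ) (S : ℝ)
    (h : ∀ u v, G.Adj u v → |x u - x v| ≤ S) {u v : Fin n} (p : G.Walk u v) :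
    |x u - x v| ≤ p.length * S := by
  induction p with
  | nil => simp
  | cons hadj p ih =>
    rename_i a b c
    have h1 := h _ _ hadj
    have h2 := abs_sub_le (x a) (x b) (x c)
    rw [SimpleGraph.Walk.length_cons]
    push_cast
    linarith

/-- for a connected graph on `n ≥ 2` vertices and `x ⊥ 𝟙`,
`n⁻² · ‖x‖_∞ ≤ ‖x‖_L` for the unit-weight Laplacian `L = BᵀB`.
(Note `‖x‖` is the sup norm for `x : Fin n → ℝ`.) -/
theorem infty_le_lapNorm {n m : ℕ} (hn : 2 ≤ n)
    (ends : Fin m → Fin n × Fin n)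
    (hloop : ∀ e, (ends e).1 ≠ (ends e).2)
    (hsimple : Function.Injective fun e => s((ends e).1, (ends e).2))
    (hconn : (graphOf ends).Connected) :
    ∀ x : Fin n → ℝ, ∑ i, x i = 0 →
      ((n : ℝ) ^ 2)⁻¹ * ‖x‖ ≤ Real.sqrt (x ⬝ᵥ ((incB ends)ᵀ * incB ends).mulVec x) := by
  intro x hx
  rw [lap_quad]
  set S := Real.sqrt (∑ e, (x (ends e).1 - x (ends e).2) ^ 2) with hS
  have hS0 : 0 ≤ S := Real.sqrt_nonneg _
  have he : ∀ e, |x (ends e).1 - x (ends e).2| ≤ S := by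
    intro e
    apply Real.abs_le_sqrt
    exact Finset.single_le_sum (f := fun e => (x (ends e).1 - x (ends e).2) ^ 2)
      (fun i _ => sq_nonneg _) (Finset.mem_univ e)
  have hadj : ∀ u v, (graphOf ends).Adj u v → |x u - x v| ≤ S := by
    intro u v huv
    rw [graphOf, SimpleGraph.fromRel_adj] at huv
    obtain ⟨_, ⟨e, h⟩ | ⟨e, h⟩⟩ := huv
    · simpa [h] using he e
    · rw [abs_sub_comm]
      simpa [h] using he e
  have hn0 : (2 : ℝ) ≤ n := by exact_mod_cast hn
  have hpair : ∀ u v, |x u - x v| ≤ n * S := by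
    intro u v
    obtain ⟨p, hp⟩ := (hconn.preconnected u v).exists_isPath
    have h1 := walk_bound _ x S hadj p
    have h2 := hp.length_lt
    rw [Fintype.card_fin] at h2
    have h3 : (p.length : ℝ) ≤ n := by exact_mod_cast h2.le
    exact h1.trans (mul_le_mul_of_nonneg_right h3 hS0)
  have hb : ∀ i, ‖x i‖ ≤ n ^ 2 * S := by
    intro i
    have h1 : (n : ℝ) * x i = ∑ j, (x i - x j) := by
      simp [Finset.sum_sub_distrib, hx]
    have h2 : |(n : ℝ) * x i| ≤ n * (n * S) := by
      rw [h1]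
      refine (Finset.abs_sum_le_sum_abs _ _).trans ?_
      refine (Finset.sum_le_sum fun j _ => hpair i j).trans ?_
      simp
    rw [abs_mul, Nat.abs_cast] at h2
    rw [Real.norm_eq_abs]
    nlinarith [abs_nonneg (x i)]
  have hnorm : ‖x‖ ≤ n ^ 2 * S := (pi_norm_le_iff_of_nonneg (by positivity)).2 hb
  rw [inv_mul_le_iff₀ (by positivity)]
  exact hnorm
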